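/- There do not exist two positive integers r and v such that both r² + v² and r² − v² are perfect (integer) squares. -/

import Mathlib

theorem Int.exists_sq_of_isCoprime_of_mul_eq_sq {a b c : ℤ} (ha : 0 < a) (hb : 0 < b)
    (h : IsCoprime a b) (hc : a * b = c ^ 2) : (∃ s, a = s ^ 2) ∧ ∃ t, b = t ^ 2 := by
  have key : ∀ {x y : ℤ}, 0 < x → IsCoprime x y → x * y = c ^ 2 → ∃ s, x = s ^ 2 := by
    intro x y hx hxy hc
    obtain ⟨s, hs | hs⟩ := Int.sq_of_isCoprime hxy hc
    · exact ⟨s, hs⟩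
    · nlinarith [sq_nonneg s]
  exact ⟨key ha h hc, key hb h.symm (by rw [mul_comm, hc])⟩

/-- The descent step: a primitive right triangle whose doubled product of legs is a square gives a
smaller coprime pair whose sum and difference of squares are both squares. -/
theorem PythagoreanTriple.exists_coprime_sq_add_sq_sub_sq {x y r v : ℤ}
    (h : PythagoreanTriple x y r) (hx : 0 < x) (hy : 0 < y) (hr : 0 < r) (hxy : Int.gcd x y = 1)
    (hodd : x % 2 = 1) (hv : 2 * (x * y) = v ^ 2) :
    ∃ s t : ℤ, 0 < s ∧ 0 < t ∧ s < r ∧ IsCoprime s t ∧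
      (∃ a, s ^ 2 + t ^ 2 = a ^ 2) ∧ ∃ b, s ^ 2 - t ^ 2 = b ^ 2 := by
  obtain ⟨m, n, rfl, rfl, rfl, hmn, hpar, hm0⟩ := h.coprime_classification' hxy hodd hr
  have hn : 0 < n := by
    by_contra! hn
    nlinarith
  have hm : 0 < m := by
    by_contra! hm
    nlinarith
  have hsub : 0 < m - n := by
    by_contra! hlt
    nlinarith
  have hmn' : IsCoprime m n := Int.isCoprime_iff_gcd_eq_one.mpr hmn
  obtain ⟨w, rfl⟩ : 2 ∣ v := Int.prime_two.dvd_of_dvd_pow ⟨_, hv.symm⟩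
  have hm_add : IsCoprime m (m + n) := by simpa [add_comm] using hmn'.add_mul_left_right 1
  have hm_sub : IsCoprime m (m - n) := by
    simpa [sub_eq_neg_add] using hmn'.neg_right.add_mul_left_right 1
  have hn_add : IsCoprime n (m + n) := by simpa using hmn'.symm.add_mul_left_right 1
  have hn_sub : IsCoprime n (m - n) := by
    simpa [sub_eq_add_neg] using hmn'.symm.add_mul_left_right (-1)
  have hadd_sub : IsCoprime (m + n) (m - n) := by
    have htwo : IsCoprime (2 : ℤ) (m - n) := by
      refine (Int.prime_two.coprime_iff_not_dvd).mpr fun hd => ?_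
      omega
    have := (hm_sub.mul_left htwo).add_mul_left_left (-1)
    rwa [show m * 2 + (m - n) * (-1) = m + n by ring] at this
  have hw : (m * n) * ((m + n) * (m - n)) = w ^ 2 := by linarith
  obtain ⟨⟨c, hc⟩, ⟨d, hd⟩⟩ := Int.exists_sq_of_isCoprime_of_mul_eq_sq (mul_pos hm hn)
    (mul_pos (by omega) hsub)
    ((hm_add.mul_right hm_sub).mul_left (hn_add.mul_right hn_sub)) hw
  obtain ⟨⟨s, hs⟩, ⟨t, ht⟩⟩ := Int.exists_sq_of_isCoprime_of_mul_eq_sq hm hn hmn' hc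
  obtain ⟨⟨a, ha⟩, ⟨b, hb⟩⟩ :=
    Int.exists_sq_of_isCoprime_of_mul_eq_sq (by omega) hsub hadd_sub hd
  have hs0 : 0 < |s| := abs_pos.mpr fun h => by simp [h] at hs; omega
  have ht0 : 0 < |t| := abs_pos.mpr fun h => by simp [h] at ht; omega
  have hcop : IsCoprime s t := by
    rw [hs, ht] at hmn'
    exact (IsCoprime.pow_iff two_pos two_pos).mp hmn'
  refine ⟨|s|, |t|, hs0, ht0, ?_, hcop.abs_abs, ⟨a, ?_⟩, ⟨b, ?_⟩⟩
  · have := sq_abs s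
    nlinarith
  · rw [sq_abs, sq_abs, ← hs, ← ht, ha]
  · rw [sq_abs, sq_abs, ← hs, ← ht, hb]

theorem not_sq_add_sq_and_sq_sub_sq_of_isCoprime {r v a b : ℤ} (hr : 0 < r) (hv : 0 < v)
    (hrv : IsCoprime r v) (ha : r ^ 2 + v ^ 2 = a ^ 2) (hb : r ^ 2 - v ^ 2 = b ^ 2) : False := by
  induction hk : r.toNat using Nat.strong_induction_on generalizing r v a b with
  | _ k ih =>
  wlog ha0 : 0 ≤ a generalizing a
  · exact this (a := -a) (by rw [neg_sq, ha]) (by omega)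
  wlog hb0 : 0 ≤ b generalizing b
  · exact this (b := -b) (by rw [neg_sq, hb]) (by omega)
  have hlt : b < a := by nlinarith
  obtain ⟨y, hy⟩ : 2 ∣ a - b := by
    have h : Even (a ^ 2 - b ^ 2) := ⟨v ^ 2, by linarith⟩
    simp only [Int.even_sub, Int.even_pow, ne_eq, OfNat.ofNat_ne_zero, not_false_eq_true,
      and_true] at h
    exact (Int.even_sub.mpr h).two_dvd
  obtain rfl : a = b + 2 * y := by linarith
  have hx : 0 < b + y := by omega
  have hy0 : 0 < y := by omega
  have htri : (b + y) ^ 2 + y ^ 2 = r ^ 2 := by linarith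
  have harea : 2 * ((b + y) * y) = v ^ 2 := by linarith
  have hgcd : Int.gcd (b + y) y = 1 := by
    have hl := Int.gcd_dvd_left (b + y) y
    have hr' := Int.gcd_dvd_right (b + y) y
    have h1 : ((Int.gcd (b + y) y : ℕ) : ℤ) ∣ r := by
      rw [← Int.pow_dvd_pow_iff two_ne_zero, ← htri]
      exact dvd_add (pow_dvd_pow_of_dvd hl 2) (pow_dvd_pow_of_dvd hr' 2)
    have h2 : ((Int.gcd (b + y) y : ℕ) : ℤ) ∣ v := by
      rw [← Int.pow_dvd_pow_iff two_ne_zero, ← harea, sq]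
      exact (mul_dvd_mul hl hr').mul_left 2
    simpa using Int.isUnit_iff_natAbs_eq.mp (hrv.isUnit_of_dvd' h1 h2)
  have htriple : PythagoreanTriple (b + y) y r := by
    unfold PythagoreanTriple
    linarith
  obtain ⟨s, t, hs, ht, hsr, hst, ⟨a', ha'⟩, ⟨b', hb'⟩⟩ : ∃ s t : ℤ, 0 < s ∧ 0 < t ∧ s < r ∧
      IsCoprime s t ∧ (∃ a, s ^ 2 + t ^ 2 = a ^ 2) ∧ ∃ b, s ^ 2 - t ^ 2 = b ^ 2 := by
    rcases htriple.even_odd_of_coprime hgcd with hpar | hpar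
    · exact htriple.symm.exists_coprime_sq_add_sq_sub_sq hy0 hx hr (by rwa [Int.gcd_comm])
        hpar.2 (by rw [mul_comm y, harea])
    · exact htriple.exists_coprime_sq_add_sq_sub_sq hx hy0 hr hgcd hpar.1 harea
  exact ih s.toNat (by omega) hs ht hst ha' hb' rfl

/-- Lemma 1: there do not exist two positive integers both of whose sum and
difference of squares are integer squares. -/
theorem no_sum_and_diff_of_squares_both_squares :
    ¬ ∃ r v : ℤ, 0 < r ∧ 0 < v ∧
      (∃ a : ℤ, r ^ 2 + v ^ 2 = a ^ 2) ∧ (∃ b : ℤ, r ^ 2 - v ^ 2 = b ^ 2) := by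
  rintro ⟨r, v, hr, hv, ⟨a, ha⟩, ⟨b, hb⟩⟩
  have hg : 0 < Int.gcd r v := Int.gcd_pos_of_ne_zero_left v hr.ne'
  obtain ⟨r', v', hcop, hr', hv'⟩ := Int.exists_gcd_one hg
  generalize Int.gcd r v = g at *
  have hg' : (0 : ℤ) < g := by exact_mod_cast hg
  subst hr' hv'
  obtain ⟨a', rfl⟩ : (g : ℤ) ∣ a := by
    rw [← Int.pow_dvd_pow_iff two_ne_zero, ← ha]
    exact ⟨r' ^ 2 + v' ^ 2, by ring⟩
  obtain ⟨b', rfl⟩ : (g : ℤ) ∣ b := by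
    rw [← Int.pow_dvd_pow_iff two_ne_zero, ← hb]
    exact ⟨r' ^ 2 - v' ^ 2, by ring⟩
  have hg2 : (g : ℤ) ^ 2 ≠ 0 := by positivity
  exact not_sq_add_sq_and_sq_sub_sq_of_isCoprime (pos_of_mul_pos_left hr hg'.le)
    (pos_of_mul_pos_left hv hg'.le) (Int.isCoprime_iff_gcd_eq_one.mpr hcop)
    (mul_left_cancel₀ hg2 (by linarith : _ = (g : ℤ) ^ 2 * a' ^ 2))
    (mul_left_cancel₀ hg2 (by linarith : _ = (g : ℤ) ^ 2 * b' ^ 2))
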